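/- Let ℏ > 0, let H₁, …, H_N : ℝ → M be continuous families of Hermitian D×D complex matrices, and for each k let ψ_k : ℝ → ℂ^D be differentiable with iℏ ψ_k'(t) = H_k(t) ψ_k(t) and common initial condition ψ_k(0) = ψ₀, where ψ₀ is a unit vector. Set ρ(t) = (1/N) Σ_k |ψ_k(t)⟩⟨ψ_k(t)| (each ψ_k(t) remains a unit vector). Then the function t ↦ Tr(ρ(t)²) is differentiable at t = 0 and its derivative at t = 0 is zero. -/

import Mathlib

open Matrix

/-- A Schrödinger velocity is skew with respect to the state. -/
lemma inner_add_inner_eq_zero_of_schrodinger {E : Type*} [NormedAddCommGroup E]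
    [InnerProductSpace ℂ E] {T : E →ₗ[ℂ] E} (hT : T.IsSymmetric) {c : ℝ} (hc : c ≠ 0) {x v : E}
    (h : (Complex.I * (c : ℂ)) • v = T x) : inner ℂ x v + inner ℂ v x = 0 := by
  have hsymm := hT x x
  rw [← h, inner_smul_left, inner_smul_right] at hsymm
  simp only [map_mul, Complex.conj_I, Complex.conj_ofReal] at hsymm
  have hne : Complex.I * (c : ℂ) ≠ 0 :=
    mul_ne_zero Complex.I_ne_zero (Complex.ofReal_ne_zero.mpr hc)
  refine (mul_eq_zero.mp ?_).resolve_left hne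
  linear_combination -hsymm

/-- The purity of a uniform mixture of rank-one operators in terms of pairwise overlaps. -/
lemma trace_sq_smul_sum_rankOne {n ι : Type*} [Fintype n] [DecidableEq n] [Fintype ι] (c : ℂ)
    (φ : ι → EuclideanSpace ℂ n) :
    ((c • ∑ k, Matrix.of fun i j => φ k i * starRingEnd ℂ (φ k j)) ^ 2).trace =
      c ^ 2 * ∑ k, ∑ l, inner ℂ (φ k) (φ l) * inner ℂ (φ l) (φ k) := by
  rw [smul_pow, Matrix.trace_smul, smul_eq_mul, pow_two (∑ k, _), Finset.sum_mul_sum]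
  simp only [Matrix.trace_sum]
  congr 1
  refine Finset.sum_congr rfl fun k _ => Finset.sum_congr rfl fun l _ => ?_
  simp only [Matrix.trace, Matrix.diag, Matrix.mul_apply, Matrix.of_apply, PiLp.inner_apply,
    RCLike.inner_apply]
  rw [mul_comm, Finset.sum_mul_sum]
  refine Finset.sum_congr rfl fun i _ => Finset.sum_congr rfl fun j _ => ?_
  ring

/-- **The first derivative of the purity of a statistical Ehrenfest ensemble vanishes at
`t = 0`.**  Let `ℏ > 0`, let `H k` (for `k = 1, …, N`) be continuous families of Hermitian
`D × D` complex matrices, and let each `ψ k : ℝ → ℂ^D` solve `iℏ ψ_k'(t) = H_k(t) ψ_k(t)`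
with the common initial condition `ψ_k(0) = ψ₀`, a unit vector.  With
`ρ t = (1/N) Σ_k |ψ_k t⟩⟨ψ_k t|`, the purity `t ↦ Tr(ρ(t)²)` is differentiable at `t = 0`
with derivative zero. -/
theorem ehrenfest_ensemble_purity_deriv_zero (D N : ℕ) (ℏ : ℝ) (hℏ : 0 < ℏ)
    (H : Fin N → ℝ → Matrix (Fin D) (Fin D) ℂ)
    (hHherm : ∀ k t, (H k t).IsHermitian)
    (hHcont : ∀ k i j, Continuous fun t => H k t i j)
    (ψ ψ' : Fin N → ℝ → EuclideanSpace ℂ (Fin D))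
    (hψdiff : ∀ k t, HasDerivAt (ψ k) (ψ' k t) t)
    (hSchr : ∀ k t, (Complex.I * (ℏ : ℂ)) • ψ' k t = Matrix.toEuclideanLin (H k t) (ψ k t))
    (ψ₀ : EuclideanSpace ℂ (Fin D)) (hψ₀ : ‖ψ₀‖ = 1)
    (hinit : ∀ k, ψ k 0 = ψ₀)
    (ρ : ℝ → Matrix (Fin D) (Fin D) ℂ)
    (hρ : ∀ t, ρ t = ((N : ℂ))⁻¹ • ∑ k, Matrix.of fun i i' =>
      ψ k t i * starRingEnd ℂ (ψ k t i')) :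
    HasDerivAt (fun t => (ρ t ^ 2).trace) 0 0 := by
  simp only [hρ, trace_sq_smul_sum_rankOne]
  have hskew : ∀ k, inner ℂ ψ₀ (ψ' k 0) + inner ℂ (ψ' k 0) ψ₀ = 0 := fun k =>
    inner_add_inner_eq_zero_of_schrodinger
      (Matrix.isSymmetric_toEuclideanLin_iff.mpr (hHherm k 0)) hℏ.ne' (hinit k ▸ hSchr k 0)
  have hpair : ∀ k l, HasDerivAt
      (fun t => inner ℂ (ψ k t) (ψ l t) * inner ℂ (ψ l t) (ψ k t)) 0 0 := by
    intro k l
    refine (((hψdiff k 0).inner ℂ (hψdiff l 0)).mul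
      ((hψdiff l 0).inner ℂ (hψdiff k 0))).congr_deriv ?_
    simp only [hinit, inner_self_eq_norm_sq_to_K, hψ₀]
    push_cast
    linear_combination hskew k + hskew l
  have hsum := (HasDerivAt.fun_sum (u := Finset.univ) fun k _ =>
    HasDerivAt.fun_sum (u := Finset.univ) fun l _ => hpair k l).const_mul (((N : ℂ))⁻¹ ^ 2)
  simpa using hsum
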